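/- The self-dual 4-form ω₊ := e^{1234}+e^{1256}+e^{1278}+e^{1357}+e^{1467}+e^{1368}+e^{1458} on ℝ⁸ (the sum of the seven basic self-dual forms with all coefficients +1) has comass exactly 2. -/

import Mathlib

noncomputable section

open scoped BigOperators
open Matrix

/-- `ℝ⁸` with its standard Euclidean structure. -/
abbrev E8 : Type := EuclideanSpace ℝ (Fin 8)

/-- The standard orthonormal basis `e₁, …, e₈` of `ℝ⁸`. -/
def stdB : Fin 8 → E8 := fun i => EuclideanSpace.single i 1

/-- The `j`-th coordinate functional `eʲ`. -/
def coordL (j : Fin 8) : E8 →ₗ[ℝ] ℝ :=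
  (LinearMap.proj j).comp (WithLp.linearEquiv 2 ℝ (Fin 8 → ℝ)).toLinearMap

/-- Alternating 4-forms on `ℝ⁸`. -/
abbrev Form4 : Type := AlternatingMap ℝ E8 ℝ (Fin 4)

/-- The decomposable 4-form `eᵃ∧eᵇ∧eᶜ∧eᵈ` (value `det` of the coordinates). -/
def wedge4 (a b c d : Fin 8) : Form4 :=
  (Matrix.detRowAlternating : AlternatingMap ℝ (Fin 4 → ℝ) ℝ (Fin 4)).compLinearMap
    (LinearMap.pi (fun i : Fin 4 => coordL (![a, b, c, d] i)))

/-- The comass `‖ω‖` of a 4-form: the sup of values on unit vectors. -/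
def comass (ω : Form4) : ℝ :=
  sSup {r : ℝ | ∃ v : Fin 4 → E8, (∀ i, ‖v i‖ = 1) ∧ ω v = r}

open scoped Classical in
/-- The square `|ω|²` of the Euclidean norm of a 4-form:
the sum of the squares of the coefficients over increasing multi-indices. -/
def eNormSq (ω : Form4) : ℝ :=
  ∑ f ∈ Finset.univ.filter (fun f : Fin 4 → Fin 8 => StrictMono f),
    (ω (fun i => stdB (f i))) ^ 2

/-- `e^{1234}` (1-indexed), i.e. `e¹∧e²∧e³∧e⁴` plus its Hodge dual. -/
def E1234 : Form4 := wedge4 0 1 2 3 + wedge4 4 5 6 7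
def E1256 : Form4 := wedge4 0 1 4 5 + wedge4 2 3 6 7
def E1278 : Form4 := wedge4 0 1 6 7 + wedge4 2 3 4 5
def E1357 : Form4 := wedge4 0 2 4 6 + wedge4 1 3 5 7
def E1467 : Form4 := wedge4 0 3 5 6 + wedge4 1 2 4 7
def E1368 : Form4 := wedge4 0 2 5 7 + wedge4 1 3 4 6
def E1458 : Form4 := wedge4 0 3 4 7 + wedge4 1 2 5 6

/-- The Cayley form. -/
def cay : Form4 := E1234 + E1256 + E1278 + E1357 - E1368 - E1458 - E1467

/-- A 4-form on `ℝ⁸` is self-dual if `ω(e_f) = ω(e_g)` whenever `f`, `g` are complementary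
increasing multi-indices whose concatenation is an even permutation of `(1,…,8)`
(i.e. induces the standard orientation). -/
def SelfDual (ω : Form4) : Prop :=
  ∀ (f g : Fin 4 → Fin 8) (σ : Equiv.Perm (Fin 8)),
    StrictMono f → StrictMono g →
    (∀ i : Fin 8, σ i = Fin.append f g (Fin.cast (by norm_num) i)) →
    Equiv.Perm.sign σ = 1 →
    ω (fun i => stdB (f i)) = ω (fun i => stdB (g i))

/-- Membership in `SO(8)`, as real `8 × 8` matrices. -/
def IsSO8 (g : Matrix (Fin 8) (Fin 8) ℝ) : Prop := g * gᵀ = 1 ∧ g.det = 1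

/-- The linear action of an `8 × 8` matrix on `ℝ⁸`. -/
def mulVecL (g : Matrix (Fin 8) (Fin 8) ℝ) : E8 →ₗ[ℝ] E8 :=
  (WithLp.linearEquiv 2 ℝ (Fin 8 → ℝ)).symm.toLinearMap ∘ₗ
    g.mulVecLin ∘ₗ (WithLp.linearEquiv 2 ℝ (Fin 8 → ℝ)).toLinearMap

/-- The action of a matrix `g` on 4-forms: `(g·ω)(v₁,…,v₄) = ω(g⁻¹v₁,…,g⁻¹v₄)`. -/
def formAct (g : Matrix (Fin 8) (Fin 8) ℝ) (ω : Form4) : Form4 :=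
  ω.compLinearMap (mulVecL g⁻¹)

/-- Two 4-forms are `SO(8)`-conjugate if they lie in the same orbit. -/
def SOConj (ω η : Form4) : Prop := ∃ g, IsSO8 g ∧ formAct g ω = η

/-- The sum of the seven basic self-dual forms with all coefficients `+1`. -/
def omegaPlus : Form4 := E1234 + E1256 + E1278 + E1357 + E1467 + E1368 + E1458

/-- The octonion product on `ℝ⁸` attached to the Cayley form `cay`, with unit `e₁`. -/
def octMul (x y : Fin 8 → ℝ) : Fin 8 → ℝ :=
  ![x 0 * y 0 - x 1 * y 1 - x 2 * y 2 - x 3 * y 3 - x 4 * y 4 - x 5 * y 5 - x 6 * y 6 - x 7 * y 7,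
    x 0 * y 1 + x 1 * y 0 - x 2 * y 3 + x 3 * y 2 - x 4 * y 5 + x 5 * y 4 - x 6 * y 7 + x 7 * y 6,
    x 0 * y 2 + x 1 * y 3 + x 2 * y 0 - x 3 * y 1 - x 4 * y 6 + x 5 * y 7 + x 6 * y 4 - x 7 * y 5,
    x 0 * y 3 - x 1 * y 2 + x 2 * y 1 + x 3 * y 0 + x 4 * y 7 + x 5 * y 6 - x 6 * y 5 - x 7 * y 4,
    x 0 * y 4 + x 1 * y 5 + x 2 * y 6 - x 3 * y 7 + x 4 * y 0 - x 5 * y 1 - x 6 * y 2 + x 7 * y 3,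
    x 0 * y 5 - x 1 * y 4 - x 2 * y 7 - x 3 * y 6 + x 4 * y 1 + x 5 * y 0 + x 6 * y 3 + x 7 * y 2,
    x 0 * y 6 + x 1 * y 7 - x 2 * y 4 + x 3 * y 5 + x 4 * y 2 - x 5 * y 3 + x 6 * y 0 - x 7 * y 1,
    x 0 * y 7 - x 1 * y 6 + x 2 * y 5 + x 3 * y 4 - x 4 * y 3 - x 5 * y 2 + x 6 * y 1 + x 7 * y 0]

/-- Octonion conjugation. -/
def octConj (x : Fin 8 → ℝ) : Fin 8 → ℝ :=
  ![x 0, -x 1, -x 2, -x 3, -x 4, -x 5, -x 6, -x 7]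

lemma dotProduct_fin_eight (x y : Fin 8 → ℝ) :
    x ⬝ᵥ y = x 0 * y 0 + x 1 * y 1 + x 2 * y 2 + x 3 * y 3 + x 4 * y 4 + x 5 * y 5
      + x 6 * y 6 + x 7 * y 7 := by
  simp [dotProduct, Fin.sum_univ_eight]

lemma octMul_dotProduct_self (x y : Fin 8 → ℝ) :
    octMul x y ⬝ᵥ octMul x y = (x ⬝ᵥ x) * (y ⬝ᵥ y) := by
  simp only [dotProduct_fin_eight, octMul, Matrix.cons_val]
  ring

lemma octConj_dotProduct_self (x : Fin 8 → ℝ) : octConj x ⬝ᵥ octConj x = x ⬝ᵥ x := by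
  simp only [dotProduct_fin_eight, octConj, Matrix.cons_val]
  ring

/-- Left multiplication by `octConj x` is adjoint to left multiplication by `x`. -/
lemma octMul_dotProduct (x y z : Fin 8 → ℝ) :
    octMul x y ⬝ᵥ z = y ⬝ᵥ octMul (octConj x) z := by
  simp only [dotProduct_fin_eight, octMul, octConj, Matrix.cons_val]
  ring

lemma octMul_conj_dotProduct_octMul_conj (x y z : Fin 8 → ℝ) :
    octMul (octConj y) z ⬝ᵥ octMul (octConj x) z = (z ⬝ᵥ z) * (x ⬝ᵥ y) := by
  simp only [dotProduct_fin_eight, octMul, octConj, Matrix.cons_val]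
  ring

lemma octMul_conj_self (x y : Fin 8 → ℝ) :
    y ⬝ᵥ octMul (octConj x) x = (x ⬝ᵥ x) * y 0 := by
  simp only [dotProduct_fin_eight, octMul, octConj, Matrix.cons_val]
  ring

lemma octMul_conj_zero (x y : Fin 8 → ℝ) : octMul (octConj x) y 0 = x ⬝ᵥ y := by
  simp only [dotProduct_fin_eight, octMul, octConj, Matrix.cons_val]
  ring

lemma octMul_conj_dotProduct_mid (x y z : Fin 8 → ℝ) :
    octMul x (octMul (octConj y) z) ⬝ᵥ y
      = 2 * (x ⬝ᵥ y) * (y ⬝ᵥ z) - (y ⬝ᵥ y) * (x ⬝ᵥ z) := by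
  simp only [dotProduct_fin_eight, octMul, octConj, Matrix.cons_val]
  ring

/-- The triple cross product of the octonions: the alternating part of `x (ȳ z)`. -/
def tripleCross (x y z : Fin 8 → ℝ) : Fin 8 → ℝ :=
  octMul x (octMul (octConj y) z) - ((x ⬝ᵥ y) • z + (y ⬝ᵥ z) • x - (x ⬝ᵥ z) • y)

/-- The squared length of the triple cross product is the Gram determinant. -/
lemma tripleCross_dotProduct_self (x y z : Fin 8 → ℝ) :
    tripleCross x y z ⬝ᵥ tripleCross x y z
      = (x ⬝ᵥ x) * (y ⬝ᵥ y) * (z ⬝ᵥ z) + 2 * (x ⬝ᵥ y) * (y ⬝ᵥ z) * (x ⬝ᵥ z)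
        - (x ⬝ᵥ x) * (y ⬝ᵥ z) ^ 2 - (y ⬝ᵥ y) * (x ⬝ᵥ z) ^ 2 - (z ⬝ᵥ z) * (x ⬝ᵥ y) ^ 2 := by
  have hp : octMul x (octMul (octConj y) z) ⬝ᵥ octMul x (octMul (octConj y) z)
      = (x ⬝ᵥ x) * ((y ⬝ᵥ y) * (z ⬝ᵥ z)) := by
    rw [octMul_dotProduct_self, octMul_dotProduct_self, octConj_dotProduct_self]
  have hx : octMul x (octMul (octConj y) z) ⬝ᵥ x = (x ⬝ᵥ x) * (y ⬝ᵥ z) := by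
    rw [octMul_dotProduct, octMul_conj_self, octMul_conj_zero]
  have hz : octMul x (octMul (octConj y) z) ⬝ᵥ z = (z ⬝ᵥ z) * (x ⬝ᵥ y) := by
    rw [octMul_dotProduct, octMul_conj_dotProduct_octMul_conj]
  have hy := octMul_conj_dotProduct_mid x y z
  unfold tripleCross
  generalize octMul x (octMul (octConj y) z) = p at *
  simp only [sub_dotProduct, dotProduct_sub, add_dotProduct, dotProduct_add, smul_dotProduct,
    dotProduct_smul, smul_eq_mul, hp, hx, hy, hz, dotProduct_comm x p, dotProduct_comm y p,
    dotProduct_comm z p, dotProduct_comm y x, dotProduct_comm z x, dotProduct_comm z y]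
  ring

lemma wedge4_apply (a b c d : Fin 8) (v : Fin 4 → E8) :
    wedge4 a b c d v = Matrix.det (Matrix.of fun i j => v i (![a, b, c, d] j)) := rfl

lemma wedge4_eq (a b c d : Fin 8) (v : Fin 4 → E8) :
    wedge4 a b c d v =
      (v 0 a * v 1 b - v 0 b * v 1 a) * (v 2 c * v 3 d - v 2 d * v 3 c)
      - (v 0 a * v 1 c - v 0 c * v 1 a) * (v 2 b * v 3 d - v 2 d * v 3 b)
      + (v 0 a * v 1 d - v 0 d * v 1 a) * (v 2 b * v 3 c - v 2 c * v 3 b)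
      + (v 0 b * v 1 c - v 0 c * v 1 b) * (v 2 a * v 3 d - v 2 d * v 3 a)
      - (v 0 b * v 1 d - v 0 d * v 1 b) * (v 2 a * v 3 c - v 2 c * v 3 a)
      + (v 0 c * v 1 d - v 0 d * v 1 c) * (v 2 a * v 3 b - v 2 b * v 3 a) := by
  rw [wedge4_apply]
  simp [Matrix.det_succ_row_zero, Fin.sum_univ_succ, Fin.succAbove]
  ring

lemma cay_eq_tripleCross (v : Fin 4 → E8) :
    cay v = tripleCross (v 0) (v 1) (v 2) ⬝ᵥ (v 3) := by
  simp only [cay, E1234, E1256, E1278, E1357, E1368, E1458, E1467, AlternatingMap.add_apply,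
    AlternatingMap.sub_apply, wedge4_eq, tripleCross, dotProduct_fin_eight, octMul, octConj,
    Matrix.cons_val, Pi.sub_apply, Pi.add_apply, Pi.smul_apply, smul_eq_mul]
  ring

lemma dotProduct_self_of_norm_eq_one {x : E8} (hx : ‖x‖ = 1) : (x : Fin 8 → ℝ) ⬝ᵥ x = 1 := by
  have := EuclideanSpace.real_norm_sq_eq x
  simp only [hx, pow_two] at this
  simpa [dotProduct] using this.symm

lemma dotProduct_sq_le (x y : Fin 8 → ℝ) : (x ⬝ᵥ y) ^ 2 ≤ (x ⬝ᵥ x) * (y ⬝ᵥ y) := by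
  simpa [dotProduct, pow_two] using Finset.sum_mul_sq_le_sq_mul_sq Finset.univ x y

/-- The Cayley form is bounded by `1` on unit vectors. -/
lemma abs_cay_le_one (v : Fin 4 → E8) (hv : ∀ i, ‖v i‖ = 1) : |cay v| ≤ 1 := by
  have h i := dotProduct_self_of_norm_eq_one (hv i)
  rw [← sq_le_one_iff_abs_le_one, cay_eq_tripleCross]
  refine (dotProduct_sq_le _ _).trans ?_
  rw [tripleCross_dotProduct_self, h, h, h, h]
  have hc := dotProduct_sq_le (v 0) (v 1)
  rw [h, h, one_mul] at hc
  generalize (v 0 : Fin 8 → ℝ) ⬝ᵥ v 1 = a at *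
  generalize (v 1 : Fin 8 → ℝ) ⬝ᵥ v 2 = b
  generalize (v 0 : Fin 8 → ℝ) ⬝ᵥ v 2 = c
  nlinarith [sq_nonneg (a - b * c), sq_nonneg (b - a * c), sq_nonneg (c - a * b),
    mul_nonneg (sub_nonneg.2 hc) (sq_nonneg b), mul_nonneg (sub_nonneg.2 hc) (sq_nonneg c)]

/-- The diagonal map of `ℝ⁸` changing the sign of the coordinates `i` and `j`. -/
def flipPair (i j : Fin 8) (x : E8) : E8 :=
  WithLp.toLp 2 fun k => (if k = i ∨ k = j then -1 else 1) * x k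

lemma norm_flipPair (i j : Fin 8) (x : E8) : ‖flipPair i j x‖ = ‖x‖ := by
  simp only [EuclideanSpace.norm_eq, flipPair]
  congr 1
  refine Finset.sum_congr rfl fun k _ => ?_
  split_ifs <;> simp

lemma wedge4_flipPair (i j a b c d : Fin 8) (v : Fin 4 → E8) :
    wedge4 a b c d (fun l => flipPair i j (v l)) =
      (if a = i ∨ a = j then -1 else 1) * (if b = i ∨ b = j then -1 else 1)
        * (if c = i ∨ c = j then -1 else 1) * (if d = i ∨ d = j then -1 else 1)
        * wedge4 a b c d v := by
  simp only [wedge4_eq, flipPair]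
  ring

/-- `ω₊` is half of a signed sum of four Cayley forms. -/
lemma omegaPlus_eq_cay (v : Fin 4 → E8) :
    omegaPlus v = (cay (fun l => flipPair 0 1 (v l)) - cay (fun l => flipPair 0 3 (v l))
      - cay (fun l => flipPair 0 5 (v l)) - cay (fun l => flipPair 0 7 (v l))) / 2 := by
  simp only [omegaPlus, cay, E1234, E1256, E1278, E1357, E1368, E1458, E1467,
    AlternatingMap.add_apply, AlternatingMap.sub_apply, wedge4_flipPair, Fin.reduceEq, or_false,
    or_true, or_self, if_true, if_false]
  ring

lemma omegaPlus_le_two (v : Fin 4 → E8) (hv : ∀ i, ‖v i‖ = 1) : omegaPlus v ≤ 2 := by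
  have h i j := abs_le.1 (abs_cay_le_one (fun l => flipPair i j (v l))
    fun l => (norm_flipPair i j (v l)).trans (hv l))
  rw [omegaPlus_eq_cay]
  linarith [(h 0 1).2, (h 0 3).1, (h 0 5).1, (h 0 7).1]

/-- The unit vectors `(e₁+e₂)/√2, (e₃+e₄)/√2, (e₅+e₆)/√2, (e₇+e₈)/√2`. -/
def diagFrame : Fin 4 → E8 :=
  ![!₂[√2⁻¹, √2⁻¹, 0, 0, 0, 0, 0, 0], !₂[0, 0, √2⁻¹, √2⁻¹, 0, 0, 0, 0],
    !₂[0, 0, 0, 0, √2⁻¹, √2⁻¹, 0, 0], !₂[0, 0, 0, 0, 0, 0, √2⁻¹, √2⁻¹]]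

lemma norm_diagFrame (i : Fin 4) : ‖diagFrame i‖ = 1 := by
  fin_cases i <;> simp [diagFrame, EuclideanSpace.norm_eq, Fin.sum_univ_eight] <;> norm_num

lemma omegaPlus_diagFrame : omegaPlus diagFrame = 2 := by
  have h : √(2⁻¹ : ℝ) * √2⁻¹ = 2⁻¹ := Real.mul_self_sqrt (by norm_num)
  simp only [omegaPlus, E1234, E1256, E1278, E1357, E1368, E1458, E1467,
    AlternatingMap.add_apply, wedge4_eq, diagFrame, Matrix.cons_val]
  simp only [h, mul_zero, zero_mul, sub_zero, add_zero, zero_add]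
  norm_num

/-- The form `ω₊` has comass exactly `2`. -/
theorem omegaPlus_comass_two : comass omegaPlus = 2 := by
  refine IsGreatest.csSup_eq ⟨⟨diagFrame, norm_diagFrame, omegaPlus_diagFrame⟩, ?_⟩
  rintro _ ⟨v, hv, rfl⟩
  exact omegaPlus_le_two v hv
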